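/- Let W ∈ M_{m×n}(ℂ) and suppose W*W has a single positive eigenvalue σ² with algebraic multiplicity q (so rank W = q). Set A = blockdiag-conjugating unitary so that W*W = A diag(σ²,...,σ²,0,...,0) A* and WW* = B diag(σ²,...,σ²,0,...,0) B*. Then the set {√q Ŵ, √q îW, q V̂}, with V̂ = blockdiag(iW*W, -iWW*) and σ² = 1/q (assuming Tr(W*W)=1), satisfies [√q Ŵ, √q îW] = 2q V̂, [q V̂, √q Ŵ] = -2√q îW, [q V̂, √q îW] = 2√q Ŵ. -/

import Mathlib

open Matrix Polynomial

lemma Matrix.IsHermitian.mul_self_eq_smul_of_eigenvalues {ι : Type*} [Fintype ι] [DecidableEq ι]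
    {H : Matrix ι ι ℂ} (hH : H.IsHermitian) (s : ℝ)
    (h : ∀ i, hH.eigenvalues i = s ∨ hH.eigenvalues i = 0) : H * H = (s : ℂ) • H := by
  have hD : diagonal ((RCLike.ofReal : ℝ → ℂ) ∘ hH.eigenvalues) *
      diagonal ((RCLike.ofReal : ℝ → ℂ) ∘ hH.eigenvalues) =
      (s : ℂ) • diagonal ((RCLike.ofReal : ℝ → ℂ) ∘ hH.eigenvalues) := by
    rw [diagonal_mul_diagonal, ← diagonal_smul]
    congr 1
    funext i
    rcases h i with h | h <;> simp [h]
  rw [hH.spectral_theorem, ← map_mul, hD, map_smul]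

open scoped ComplexOrder in
lemma Matrix.mul_conjTranspose_mul_self_of_charpoly {m n : Type*} [Fintype m] [Fintype n]
    [DecidableEq n] (W : Matrix m n ℂ) (s : ℝ) (q k : ℕ)
    (hchar : (Wᴴ * W).charpoly = (X - C (s : ℂ)) ^ q * X ^ k) :
    W * (Wᴴ * W) = (s : ℂ) • W := by
  have hH : (Wᴴ * W).IsHermitian := isHermitian_conjTranspose_mul_self W
  have hsq : (Wᴴ * W) * (Wᴴ * W) = (s : ℂ) • (Wᴴ * W) := by
    refine hH.mul_self_eq_smul_of_eigenvalues s fun i => ?_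
    have hroot : (Wᴴ * W).charpoly.eval (hH.eigenvalues i : ℂ) = 0 := by
      rw [hH.charpoly_eq, eval_prod]
      exact Finset.prod_eq_zero (Finset.mem_univ i) (by simp)
    rw [hchar, eval_mul, eval_pow, eval_pow, eval_sub, eval_X, eval_C, mul_eq_zero] at hroot
    rcases hroot with h | h
    · left
      exact_mod_cast sub_eq_zero.mp (eq_zero_of_pow_eq_zero h)
    · right
      exact_mod_cast eq_zero_of_pow_eq_zero h
  rw [← sub_eq_zero, ← conjTranspose_mul_self_eq_zero]
  have hfac : W * (Wᴴ * W) - (s : ℂ) • W = W * (Wᴴ * W - (s : ℂ) • 1) := by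
    simp [Matrix.mul_sub]
  have hann : (Wᴴ * W) * (Wᴴ * W - (s : ℂ) • 1) = 0 := by
    simp [Matrix.mul_sub, hsq]
  rw [hfac, conjTranspose_mul, Matrix.mul_assoc, ← Matrix.mul_assoc Wᴴ, hann, Matrix.mul_zero]

lemma smul_lie_smul_eq {R A : Type*} [CommRing R] [Ring A] [Algebra R A] (a b : R) (x y : A) :
    ⁅a • x, b • y⁆ = (a * b) • ⁅x, y⁆ := by
  rw [Ring.lie_def, Ring.lie_def, smul_mul_smul_comm, smul_mul_smul_comm, mul_comm b a, smul_sub]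


theorem stmt_7 {m n q : ℕ} (hq : 1 ≤ q) (hqn : q ≤ n)
    (W : Matrix (Fin m) (Fin n) ℂ) (htr : (Wᴴ * W).trace = 1)
    (σ : ℝ) (hσ : 0 < σ)
    (hchar : (Wᴴ * W).charpoly =
      (Polynomial.X - Polynomial.C ((σ ^ 2 : ℝ) : ℂ)) ^ q * Polynomial.X ^ (n - q))
    (Wh iWh Vh : Matrix (Fin n ⊕ Fin m) (Fin n ⊕ Fin m) ℂ)
    (hWh : Wh = Matrix.fromBlocks 0 Wᴴ W 0)
    (hiWh : iWh = Matrix.fromBlocks 0 (-(Complex.I • Wᴴ)) (Complex.I • W) 0)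
    (hVh : Vh = Matrix.fromBlocks (Complex.I • (Wᴴ * W)) 0 0
      (-(Complex.I • (W * Wᴴ)))) :
    σ ^ 2 = 1 / q ∧
    ⁅Real.sqrt q • Wh, Real.sqrt q • iWh⁆ = (2 : ℝ) • ((q : ℝ) • Vh) ∧
    ⁅(q : ℝ) • Vh, Real.sqrt q • Wh⁆ = -((2 : ℝ) • (Real.sqrt q • iWh)) ∧
    ⁅(q : ℝ) • Vh, Real.sqrt q • iWh⁆ = (2 : ℝ) • (Real.sqrt q • Wh) := by
  have hs : σ ^ 2 = 1 / q := by
    have h := Matrix.trace_eq_sum_roots_charpoly (Wᴴ * W)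
    rw [htr, hchar, roots_mul ((((monic_X_sub_C _).pow q).mul (monic_X.pow _)).ne_zero),
      roots_pow, roots_pow, roots_X_sub_C, roots_X, Multiset.sum_add, Multiset.sum_nsmul,
      Multiset.sum_nsmul, Multiset.sum_singleton, Multiset.sum_singleton, nsmul_zero, add_zero,
      nsmul_eq_mul] at h
    have h' : (1 : ℝ) = q * σ ^ 2 := by exact_mod_cast h
    have hq' : (q : ℝ) ≠ 0 := by positivity
    field_simp
    linarith
  have hW : (q : ℝ) • (W * Wᴴ * W) = W := by
    have hq' : (q : ℝ) ≠ 0 := by positivity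
    rw [Matrix.mul_assoc, mul_conjTranspose_mul_self_of_charpoly W _ q _ hchar, Complex.coe_smul,
      hs, smul_smul, mul_one_div_cancel hq', one_smul]
  have hW' : (q : ℝ) • (Wᴴ * W * Wᴴ) = Wᴴ := by
    simpa [Matrix.mul_assoc] using congrArg conjTranspose hW
  have hsqrt : Real.sqrt q * Real.sqrt q = q := Real.mul_self_sqrt (by positivity)
  have h₁ : ⁅Wh, iWh⁆ = (2 : ℝ) • Vh := by
    subst hWh hiWh hVh
    rw [Ring.lie_def, fromBlocks_multiply, fromBlocks_multiply, sub_eq_add_neg, fromBlocks_neg,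
      fromBlocks_add, fromBlocks_smul]
    simp [two_smul]
  have h₂ : (q : ℝ) • ⁅Vh, Wh⁆ = -((2 : ℝ) • iWh) := by
    subst hWh hiWh hVh
    rw [Ring.lie_def, fromBlocks_multiply, fromBlocks_multiply, sub_eq_add_neg, fromBlocks_neg,
      fromBlocks_add, fromBlocks_smul, fromBlocks_smul, fromBlocks_neg]
    simp [two_smul, ← Matrix.mul_assoc, smul_comm (q : ℝ) Complex.I, hW, hW']
  have h₃ : (q : ℝ) • ⁅Vh, iWh⁆ = (2 : ℝ) • Wh := by
    subst hWh hiWh hVh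
    rw [Ring.lie_def, fromBlocks_multiply, fromBlocks_multiply, sub_eq_add_neg, fromBlocks_neg,
      fromBlocks_add, fromBlocks_smul, fromBlocks_smul]
    simp [two_smul, smul_smul, ← Matrix.mul_assoc, hW, hW']
  refine ⟨hs, ?_, ?_, ?_⟩
  · rw [smul_lie_smul_eq, h₁, hsqrt, smul_comm]
  · rw [smul_lie_smul_eq, mul_comm, mul_smul, h₂, smul_neg, smul_comm]
  · rw [smul_lie_smul_eq, mul_comm, mul_smul, h₃, smul_comm]
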